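/- For every Schwartz function φ : ℝ²×ℝ → ℂ that is even in its last variable, i.e. φ(x₁₂, −x₃) = φ(x₁₂, x₃) for all (x₁₂,x₃) ∈ ℝ²×ℝ, there exists a Schwartz function g : ℝ×ℝ² → ℂ such that for all (x₁₂,x₃) ∈ ℝ²×ℝ, (1/(4π)) ∫_{ℝ²} g(√(‖x₁₂−ξ‖² + x₃²), ξ) · (√(‖x₁₂−ξ‖² + x₃²))^{−1} dξ = φ(x₁₂, x₃). In other words, every Schwartz function on ℝ³ that is even with respect to the observation plane lies in the range of the backprojection operator R* acting on Schwartz functions. -/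

import Mathlib

open MeasureTheory Real Complex

/-- Backprojection operator:
`(R*g)(x₁₂,x₃) = (1/(4π)) ∫_{ℝ²} g(√(‖x₁₂−ξ‖² + x₃²), ξ)·(√(‖x₁₂−ξ‖² + x₃²))⁻¹ dξ`. -/
noncomputable def Rstar (g : ℝ × EuclideanSpace ℝ (Fin 2) → ℂ)
    (x : EuclideanSpace ℝ (Fin 2) × ℝ) : ℂ :=
  ((1 / (4 * π) : ℝ) : ℂ) * ∫ ξ : EuclideanSpace ℝ (Fin 2),
    g (Real.sqrt (‖x.1 - ξ‖ ^ 2 + x.2 ^ 2), ξ) /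
      ((Real.sqrt (‖x.1 - ξ‖ ^ 2 + x.2 ^ 2) : ℝ) : ℂ)

open SchwartzMap FourierTransform
open scoped ContDiff

section PartialFourier

variable {V : Type} [NormedAddCommGroup V] [NormedSpace ℝ V]

/-- Uniform integrable bound for slices. -/
lemma slice_bound {F : Type} [NormedAddCommGroup F] [NormedSpace ℂ F]
    (H : 𝓢(V × ℝ, F)) (n : ℕ) :
    ∃ M : ℝ, 0 ≤ M ∧ ∀ v y, (1 + ‖v‖) ^ n * ‖H (v, y)‖ ≤ M * (1 + y ^ 2)⁻¹ := by
  refine ⟨2 ^ (n+2) * ((Finset.Iic (n+2, 0)).sup fun m => SchwartzMap.seminorm ℝ m.1 m.2) H,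
    by positivity, fun v y => ?_⟩
  have h := SchwartzMap.one_add_le_sup_seminorm_apply (𝕜 := ℝ) (m := (n+2, 0)) (k := n+2) (n := 0)
    le_rfl le_rfl H (v, y)
  rw [norm_iteratedFDeriv_zero] at h
  rw [← div_eq_mul_inv, le_div_iff₀ (by positivity)]
  refine le_trans ?_ h
  have h1 : ‖v‖ ≤ ‖(v, y)‖ := norm_fst_le (v, y)
  have h2 : |y| ≤ ‖(v, y)‖ := norm_snd_le (v, y)
  have h3 : 1 + y ^ 2 ≤ (1 + ‖(v, y)‖) ^ 2 := by
    have : y ^ 2 ≤ ‖(v, y)‖ ^ 2 := by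
      rw [← sq_abs]; gcongr
    nlinarith [norm_nonneg (v, y)]
  calc (1 + ‖v‖) ^ n * ‖H (v, y)‖ * (1 + y ^ 2)
      ≤ (1 + ‖(v, y)‖) ^ n * ‖H (v, y)‖ * (1 + ‖(v, y)‖) ^ 2 := by gcongr
    _ = _ := by ring

/-- the slice as a Schwartz function -/
lemma exists_slice {F : Type} [NormedAddCommGroup F] [NormedSpace ℂ F]
    (H : 𝓢(V × ℝ, F)) (v : V) : ∃ h : 𝓢(ℝ, F), ∀ y, h y = H (v, y) := by
  have hg : Function.HasTemperateGrowth (fun y : ℝ => (v, y)) := by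
    have : (fun y : ℝ => (v, y)) = fun y => (v, (0:ℝ)) + ContinuousLinearMap.inr ℝ V ℝ y := by
      ext y <;> simp
    rw [this]
    fun_prop
  refine ⟨SchwartzMap.compCLM ℝ hg ⟨1, 1, fun y => ?_⟩ H, fun y => rfl⟩
  have : ‖y‖ ≤ ‖(v, y)‖ := norm_snd_le (v, y)
  simp only [pow_one]; linarith

lemma slice_integrable {F : Type} [NormedAddCommGroup F] [NormedSpace ℂ F]
    (H : 𝓢(V × ℝ, F)) (v : V) : Integrable (fun y => H (v, y)) := by
  obtain ⟨h, hh⟩ := exists_slice H v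
  simpa [← hh] using h.integrable

noncomputable def JF {F : Type} [NormedAddCommGroup F] [NormedSpace ℂ F]
    (H : 𝓢(V × ℝ, F)) (x : V × ℝ) : F :=
  ∫ y : ℝ, Complex.exp (↑(-2 * π * y * x.2) * I) • H (x.1, y)

lemma JF_eq {F : Type} [NormedAddCommGroup F] [NormedSpace ℂ F]
    (H : 𝓢(V × ℝ, F)) (v : V) (w : ℝ) : JF H (v, w) = 𝓕 (fun y => H (v, y)) w := by
  rw [Real.fourier_real_eq_integral_exp_smul, JF]

lemma JF_bound {F : Type} [NormedAddCommGroup F] [NormedSpace ℂ F]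
    (H : 𝓢(V × ℝ, F)) (n : ℕ) : ∃ C, ∀ v w, (1 + ‖v‖) ^ n * ‖JF H (v, w)‖ ≤ C := by
  obtain ⟨M, hM, h⟩ := slice_bound H n
  refine ⟨∫ y : ℝ, M * (1 + y ^ 2)⁻¹, fun v w => ?_⟩
  have e1 : ‖JF H (v, w)‖ ≤ ∫ y, ‖H (v, y)‖ := by
    refine (norm_integral_le_integral_norm _).trans (le_of_eq ?_)
    congr 1 with y
    rw [norm_smul, Complex.norm_exp_ofReal_mul_I, one_mul]
  calc _ ≤ (1 + ‖v‖) ^ n * ∫ y, ‖H (v, y)‖ := by gcongr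
    _ = ∫ y, (1 + ‖v‖) ^ n * ‖H (v, y)‖ := by rw [integral_const_mul]
    _ ≤ _ := integral_mono ((slice_integrable H v).norm.const_mul _)
        (integrable_inv_one_add_sq.const_mul _) (fun y => h v y)

lemma JF_deriv {F : Type} [NormedAddCommGroup F] [NormedSpace ℂ F]
    (H : 𝓢(V × ℝ, F)) : ∃ H2 : 𝓢(V × ℝ, F), ∀ v w,
      JF H2 (v, w) = (2 * π * I * w : ℂ) • JF H (v, w) := by
  refine ⟨SchwartzMap.evalCLM ℝ _ _ ((0:V), (1:ℝ)) (SchwartzMap.fderivCLM ℝ _ _ H), fun v w => ?_⟩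
  obtain ⟨h, hh⟩ := exists_slice H v
  have hfun : (fun y => H (v, y)) = h := by ext y; rw [hh]
  have hd : (fun y => (SchwartzMap.evalCLM ℝ _ _ ((0:V), (1:ℝ)) (SchwartzMap.fderivCLM ℝ _ _ H)) (v, y))
      = deriv h := by
    ext y
    rw [← hfun]
    have h1 : HasDerivAt (fun y : ℝ => (v, y)) ((0:V), (1:ℝ)) y :=
      (hasDerivAt_const y v).prodMk (hasDerivAt_id y)
    exact ((H.hasFDerivAt (v, y)).comp_hasDerivAt y h1).deriv.symm
  rw [JF_eq, JF_eq, hd, hfun, Real.fourier_deriv h.integrable h.differentiable]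
  exact (SchwartzMap.derivCLM ℝ F h).integrable

lemma JF_decay {F : Type} [NormedAddCommGroup F] [NormedSpace ℂ F]
    (H : 𝓢(V × ℝ, F)) (n : ℕ) : ∃ C, ∀ x, ‖x‖ ^ n * ‖JF H x‖ ≤ C := by
  have key : ∀ n (H : 𝓢(V × ℝ, F)), ∃ C, ∀ v w, |w| ^ n * ‖JF H (v, w)‖ ≤ C := by
    intro n
    induction n with
    | zero =>
      intro H
      obtain ⟨C, hC⟩ := JF_bound H 0
      exact ⟨C, by simpa using hC⟩
    | succ n ih =>
      intro H
      obtain ⟨H2, h2⟩ := JF_deriv H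
      obtain ⟨C, hC⟩ := ih H2
      refine ⟨C, fun v w => le_trans ?_ (hC v w)⟩
      rw [h2, norm_smul, pow_succ, mul_assoc]
      gcongr
      simp only [norm_mul, Complex.norm_ofNat, Complex.norm_real, Complex.norm_I, mul_one,
        Real.norm_eq_abs, abs_of_pos Real.pi_pos]
      nlinarith [Real.pi_gt_three, abs_nonneg w]
  obtain ⟨C1, h1⟩ := JF_bound H n
  obtain ⟨C2, h2⟩ := key n H
  refine ⟨C1 + C2, fun x => ?_⟩
  obtain ⟨v, w⟩ := x
  have : ‖(v, w)‖ ^ n ≤ (1 + ‖v‖) ^ n + |w| ^ n := by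
    rw [Prod.norm_mk]
    rcases le_total ‖v‖ ‖w‖ with h | h
    · rw [max_eq_right h]
      have : 0 ≤ (1 + ‖v‖) ^ n := by positivity
      simpa using this
    · rw [max_eq_left h]
      have : ‖v‖ ^ n ≤ (1 + ‖v‖) ^ n := by gcongr; linarith
      have : 0 ≤ |w| ^ n := by positivity
      linarith
  calc _ ≤ ((1 + ‖v‖) ^ n + |w| ^ n) * ‖JF H (v, w)‖ := by gcongr
    _ ≤ _ := by rw [add_mul]; exact add_le_add (h1 v w) (h2 v w)

lemma JF_fderiv {F : Type} [NormedAddCommGroup F] [NormedSpace ℂ F] 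
    (H : 𝓢(V × ℝ, F)) : ∃ H2 : 𝓢(V × ℝ, V × ℝ →L[ℝ] F), ∀ x, HasFDerivAt (JF H) (JF H2 x) x := by
  have ht : Function.HasTemperateGrowth (fun x : V × ℝ => (-2 * π * I * ((x.2 : ℝ) : ℂ) : ℂ)) := by
    have : Function.HasTemperateGrowth (fun x : V × ℝ => x.2) :=
      (ContinuousLinearMap.snd ℝ V ℝ).hasTemperateGrowth
    fun_prop
  let P : V × ℝ →L[ℝ] V × ℝ := (ContinuousLinearMap.inl ℝ V ℝ).comp (ContinuousLinearMap.fst ℝ V ℝ)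
  let Q : F →L[ℝ] V × ℝ →L[ℝ] F :=
    ContinuousLinearMap.smulRightL ℝ (V × ℝ) F (ContinuousLinearMap.snd ℝ V ℝ)
  let H2 : 𝓢(V × ℝ, V × ℝ →L[ℝ] F) :=
    SchwartzMap.postcompCLM ((ContinuousLinearMap.compL ℝ (V × ℝ) (V × ℝ) F).flip P)
      (SchwartzMap.fderivCLM ℝ _ _ H) +
    SchwartzMap.postcompCLM Q (SchwartzMap.smulLeftCLM F
      (fun x : V × ℝ => (-2 * π * I * ((x.2 : ℝ) : ℂ) : ℂ)) H)
  have hH2 : ∀ v y, H2 (v, y) = (fderiv ℝ H (v, y)).comp P + Q ((-2 * π * I * (y : ℂ) : ℂ) • H (v, y)) := by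
    intro v y
    simp only [H2, add_apply, SchwartzMap.postcompCLM_apply,
      SchwartzMap.smulLeftCLM_apply_apply ht]
    rfl
  refine ⟨H2, fun x => ?_⟩
  obtain ⟨M, hM, hb⟩ := slice_bound H2 0
  refine hasFDerivAt_integral_of_dominated_of_fderiv_le (𝕜 := ℝ) (s := Set.univ)
    (F := fun (x : V × ℝ) (y : ℝ) => Complex.exp (↑(-2 * π * y * x.2) * I) • H (x.1, y))
    (F' := fun x y => Complex.exp (↑(-2 * π * y * x.2) * I) • H2 (x.1, y))
    (bound := fun y => M * (1 + y ^ 2)⁻¹) Filter.univ_mem ?_ ?_ ?_ ?_ ?_ ?_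
  · refine Filter.Eventually.of_forall fun x => ?_
    have hc : Continuous fun y : ℝ => H (x.1, y) := H.continuous.comp (by fun_prop)
    exact Continuous.aestronglyMeasurable (by fun_prop)
  · refine (integrable_norm_iff ?_).1 ?_
    · have hc : Continuous fun y : ℝ => H (x.1, y) := H.continuous.comp (by fun_prop)
      exact Continuous.aestronglyMeasurable (by fun_prop)
    · simp only [norm_smul, Complex.norm_exp_ofReal_mul_I, one_mul]
      exact (slice_integrable H x.1).norm
  · have hc : Continuous fun y : ℝ => H2 (x.1, y) := H2.continuous.comp (by fun_prop)
    exact Continuous.aestronglyMeasurable (by fun_prop)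
  · refine Filter.Eventually.of_forall fun y x _ => ?_
    rw [norm_smul, Complex.norm_exp_ofReal_mul_I, one_mul]
    simpa using hb x.1 y
  · exact integrable_inv_one_add_sq.const_mul _
  · refine Filter.Eventually.of_forall fun y x _ => ?_
    have h1 : HasFDerivAt (fun x : V × ℝ => H (x.1, y)) ((fderiv ℝ H (x.1, y)).comp P) x := by
      refine HasFDerivAt.comp x (g := H) (f := fun x : V × ℝ => (x.1, y)) (H.hasFDerivAt (x.1, y)) ?_
      have := (hasFDerivAt_fst (𝕜 := ℝ) (p := x)).prodMk (hasFDerivAt_const y x)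
      convert! this using 1
    have h0 : HasDerivAt (fun w : ℝ => Complex.exp (↑(-2 * π * y * w) * I))
        (Complex.exp (↑(-2 * π * y * x.2) * I) * (-2 * π * I * (y : ℂ))) x.2 := by
      have : HasDerivAt (fun w : ℝ => (((-2 * π * y * w : ℝ) : ℂ) * I)) (-2 * π * I * (y : ℂ)) x.2 := by
        have h := (((hasDerivAt_id x.2).const_mul (-2 * π * y)).ofReal_comp).mul_const I
        convert! h using 1
        push_cast; ring
      exact this.cexp
    have h2 : HasFDerivAt (fun x : V × ℝ => Complex.exp (↑(-2 * π * y * x.2) * I))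
        ((ContinuousLinearMap.snd ℝ V ℝ).smulRight
          (Complex.exp (↑(-2 * π * y * x.2) * I) * (-2 * π * I * (y : ℂ)))) x := by
      have := h0.hasFDerivAt.comp x (hasFDerivAt_snd (𝕜 := ℝ) (p := x))
      convert! this using 1
    have := h2.smul h1
    convert! this using 1
    rw [hH2]
    ext z
    · simp [Q]
    · simp [Q, smul_smul]

lemma JF_contDiff_decay (m : ℕ) : ∀ {F : Type} [NormedAddCommGroup F] [NormedSpace ℂ F] 
    (H : 𝓢(V × ℝ, F)), ContDiff ℝ m (JF H) ∧
      ∀ n, ∃ C, ∀ x, ‖x‖ ^ n * ‖iteratedFDeriv ℝ m (JF H) x‖ ≤ C := by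
  induction m with
  | zero =>
    intro F _ _  H
    obtain ⟨H2, h2⟩ := JF_fderiv H
    refine ⟨?_, fun n => ?_⟩
    · have : Differentiable ℝ (JF H) := fun x => (h2 x).differentiableAt
      exact contDiff_zero.2 this.continuous
    · simpa using JF_decay H n
  | succ m ih =>
    intro F _ _  H
    obtain ⟨H2, h2⟩ := JF_fderiv H
    have hf : fderiv ℝ (JF H) = JF H2 := by ext1 x; exact (h2 x).fderiv
    obtain ⟨c, d⟩ := ih H2
    refine ⟨?_, fun n => ?_⟩
    · push_cast
      rw [contDiff_succ_iff_fderiv]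
      refine ⟨fun x => (h2 x).differentiableAt, by simp, by rw [hf]; exact c⟩
    · obtain ⟨C, hC⟩ := d n
      refine ⟨C, fun x => ?_⟩
      rw [← norm_iteratedFDeriv_fderiv, hf]
      exact hC x

/-- Partial Fourier transform in the last variable preserves Schwartz functions. -/
lemma exists_partialFourier {F : Type} [NormedAddCommGroup F] [NormedSpace ℂ F] 
    (H : 𝓢(V × ℝ, F)) : ∃ K : 𝓢(V × ℝ, F), ∀ v w, K (v, w) = 𝓕 (fun y => H (v, y)) w := by
  refine ⟨⟨JF H, ?_, ?_⟩, fun v w => JF_eq H v w⟩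
  · exact contDiff_infty.2 fun m => (JF_contDiff_decay m H).1
  · exact fun n m => (JF_contDiff_decay m H).2 n

/-- Partial integral in the last variable preserves Schwartz functions. -/
lemma exists_partialIntegral {F : Type} [NormedAddCommGroup F] [NormedSpace ℂ F] 
    (H : 𝓢(V × ℝ, F)) : ∃ K : 𝓢(V, F), ∀ v, K v = ∫ y, H (v, y) := by
  obtain ⟨K, hK⟩ := exists_partialFourier H
  refine ⟨SchwartzMap.compCLM ℝ (ContinuousLinearMap.inl ℝ V ℝ).hasTemperateGrowth
    ⟨1, 1, fun v => ?_⟩ K, fun v => ?_⟩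
  · have : ‖v‖ ≤ ‖(v, (0:ℝ))‖ := norm_fst_le (v, (0:ℝ))
    simp only [pow_one, ContinuousLinearMap.inl_apply]; linarith
  · have : (SchwartzMap.compCLM ℝ (ContinuousLinearMap.inl ℝ V ℝ).hasTemperateGrowth
      (F := F) (by
      refine ⟨1, 1, fun v => ?_⟩
      have : ‖v‖ ≤ ‖(v, (0:ℝ))‖ := norm_fst_le (v, (0:ℝ))
      simp only [pow_one, ContinuousLinearMap.inl_apply]; linarith) K) v = K (v, 0) := rfl
    rw [this, hK, Real.fourier_real_eq_integral_exp_smul]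
    simp

end PartialFourier

section Whitney

lemma norm_iteratedFDeriv_comp_clm_le {X W : Type} [NormedAddCommGroup X] [NormedSpace ℝ X]
    [NormedAddCommGroup W] [NormedSpace ℝ W] (a : 𝓢(W, ℂ)) (p : X →L[ℝ] W) (i : ℕ) (x : X) :
    ‖iteratedFDeriv ℝ i (fun x => a (p x)) x‖ ≤ ‖iteratedFDeriv ℝ i a (p x)‖ * ‖p‖ ^ i := by
  have h := p.iteratedFDeriv_comp_right (a.smooth ⊤) x (i := i) (by exact_mod_cast le_top)
  have e : (fun x => a (p x)) = a ∘ p := rfl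
  rw [e, h]
  refine (ContinuousMultilinearMap.norm_compContinuousLinearMap_le _ _).trans ?_
  simp

lemma exists_tensor {X W U : Type} [NormedAddCommGroup X] [NormedSpace ℝ X]
    [NormedAddCommGroup W] [NormedSpace ℝ W] [NormedAddCommGroup U] [NormedSpace ℝ U]
    (a : 𝓢(W, ℂ)) (b : 𝓢(U, ℂ)) (p : X →L[ℝ] W) (q : X →L[ℝ] U)
    (hpq : ∀ x, 1 + ‖x‖ ≤ (1 + ‖p x‖) * (1 + ‖q x‖)) :
    ∃ K : 𝓢(X, ℂ), ∀ x, K x = a (p x) * b (q x) := by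
  have ha : ContDiff ℝ ∞ (fun x => a (p x)) := (a.smooth ⊤).comp p.contDiff
  have hb : ContDiff ℝ ∞ (fun x => b (q x)) := (b.smooth ⊤).comp q.contDiff
  refine ⟨⟨fun x => a (p x) * b (q x), ha.mul hb, fun k n => ?_⟩, fun x => rfl⟩
  have hA : ∀ i, ∃ A, ∀ y, (1 + ‖y‖) ^ k * ‖iteratedFDeriv ℝ i a y‖ ≤ A := fun i =>
    ⟨_, fun y => SchwartzMap.one_add_le_sup_seminorm_apply (𝕜 := ℝ) (m := (k, i)) (k := k) (n := i)
      le_rfl le_rfl a y⟩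
  have hB : ∀ i, ∃ A, ∀ y, (1 + ‖y‖) ^ k * ‖iteratedFDeriv ℝ i b y‖ ≤ A := fun i =>
    ⟨_, fun y => SchwartzMap.one_add_le_sup_seminorm_apply (𝕜 := ℝ) (m := (k, i)) (k := k) (n := i)
      le_rfl le_rfl b y⟩
  choose A hA using hA
  choose B hB using hB
  refine ⟨∑ i ∈ Finset.range (n + 1), (n.choose i : ℝ) * (A i * ‖p‖ ^ i) * (B (n - i) * ‖q‖ ^ (n - i)),
    fun x => ?_⟩
  have h := norm_iteratedFDeriv_mul_le ha hb x (n := n) (by exact_mod_cast le_top)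
  calc _ ≤ ((1 + ‖p x‖) ^ k * (1 + ‖q x‖) ^ k) * ∑ i ∈ Finset.range (n + 1), ↑(n.choose i) *
        ‖iteratedFDeriv ℝ i (fun x => a (p x)) x‖ * ‖iteratedFDeriv ℝ (n - i) (fun x => b (q x)) x‖ := by
        gcongr
        rw [← mul_pow]
        gcongr
        linarith [hpq x]
    _ = ∑ i ∈ Finset.range (n + 1), ↑(n.choose i) *
        ((1 + ‖p x‖) ^ k * ‖iteratedFDeriv ℝ i (fun x => a (p x)) x‖) *
        ((1 + ‖q x‖) ^ k * ‖iteratedFDeriv ℝ (n - i) (fun x => b (q x)) x‖) := by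
        rw [Finset.mul_sum]
        refine Finset.sum_congr rfl fun i _ => by ring
    _ ≤ _ := by
        refine Finset.sum_le_sum fun i _ => ?_
        have hA0 : 0 ≤ A i := le_trans (by positivity) (hA i 0)
        have h1 : (1 + ‖p x‖) ^ k * ‖iteratedFDeriv ℝ i (fun x => a (p x)) x‖ ≤ A i * ‖p‖ ^ i := by
          refine (mul_le_mul_of_nonneg_left (norm_iteratedFDeriv_comp_clm_le a p i x)
            (by positivity)).trans ?_
          rw [← mul_assoc]
          exact mul_le_mul_of_nonneg_right (hA i _) (by positivity)
        have h2 : (1 + ‖q x‖) ^ k * ‖iteratedFDeriv ℝ (n - i) (fun x => b (q x)) x‖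
            ≤ B (n - i) * ‖q‖ ^ (n - i) := by
          refine (mul_le_mul_of_nonneg_left (norm_iteratedFDeriv_comp_clm_le b q (n - i) x)
            (by positivity)).trans ?_
          rw [← mul_assoc]
          exact mul_le_mul_of_nonneg_right (hB (n - i) _) (by positivity)
        exact mul_le_mul (mul_le_mul_of_nonneg_left h1 (by positivity)) h2 (by positivity)
          (by positivity)

lemma temperate_rpow_quarter {m : ℝ → ℝ} (hm : m.HasTemperateGrowth) (h1 : ∀ s, 1 ≤ m s) :
    Function.HasTemperateGrowth (fun s => (m s) ^ (1/4 : ℝ)) := by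
  set t := {y : ℝ | 1 / 2 < y}
  have ht : Set.range m ⊆ t := by
    rintro - ⟨y, rfl⟩
    exact lt_of_lt_of_le (by norm_num) (h1 y)
  have hdiff : ContDiffOn ℝ ∞ (fun x : ℝ ↦ x ^ (1/4:ℝ)) t :=
    contDiffOn_fun_id.rpow_const_of_ne fun x hx ↦ (lt_trans (by norm_num) hx).ne'
  have hunique : UniqueDiffOn ℝ t := (isOpen_lt' (1 / 2)).uniqueDiffOn
  apply Function.HasTemperateGrowth.comp' ht hunique hdiff _ hm
  intro N
  use 1, (∑ k ∈ Finset.range (N + 1), ‖Polynomial.eval (1/4:ℝ) (descPochhammer ℝ k)‖) * 2 ^ N,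
    by positivity
  intro n hn x hx
  have : ContDiffAt ℝ n (fun x : ℝ ↦ x ^ (1/4:ℝ)) x :=
    Real.contDiffAt_rpow_const <| Or.inl (lt_trans (by norm_num) hx).ne'
  rw [norm_iteratedFDerivWithin_eq_norm_iteratedDerivWithin,
    iteratedDerivWithin_eq_iteratedDeriv hunique this hx, iteratedDeriv_eq_iterate,
    Real.iter_deriv_rpow_const, norm_mul, mul_assoc]
  gcongr 1
  · have : n ∈ Finset.range (N + 1) := by grind
    apply Finset.single_le_sum (f := fun k => ‖Polynomial.eval (1/4:ℝ) (descPochhammer ℝ k)‖)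
      (fun _ _ ↦ by positivity) this
  have hx' : 1 / 2 < x := by simpa [t] using hx
  have hx'' : 0 < x := lt_of_lt_of_le (by norm_num) hx'.le
  rw [Real.rpow_sub hx'', Real.rpow_natCast, norm_div, Real.norm_of_nonneg (by positivity),
    Real.norm_of_nonneg (by positivity), Real.norm_of_nonneg hx''.le, pow_one, div_eq_mul_inv, mul_comm]
  gcongr ?_ * ?_
  · calc (x ^ n)⁻¹ = (x⁻¹) ^ n := by rw [inv_pow]
      _ ≤ 2 ^ n := by
        gcongr
        rw [inv_le_comm₀ hx'' (by norm_num)]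
        linarith
      _ ≤ 2 ^ N := by gcongr; norm_num
  · calc x ^ (1/4:ℝ) ≤ (1 + x) ^ (1/4:ℝ) := by gcongr; linarith
      _ ≤ (1 + x) ^ (1:ℝ) := Real.rpow_le_rpow_of_exponent_le (by linarith) (by norm_num)
      _ = _ := by simp

/-- A smooth temperate function which is `√s` for `s ≥ 2`. -/
lemma exists_smooth_root : ∃ r : ℝ → ℝ, r.HasTemperateGrowth ∧ (∀ s, 2 ≤ s → r s = √s) ∧
    ∀ s, |s| ≤ r s ^ 2 := by
  let β : ContDiffBump (0:ℝ) := ⟨1, 2, by norm_num, by norm_num⟩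
  have hβ : Function.HasTemperateGrowth (β : ℝ → ℝ) :=
    β.hasCompactSupport.hasTemperateGrowth β.contDiff
  let m : ℝ → ℝ := fun s => s ^ 2 + β s
  have hm : m.HasTemperateGrowth := by
    show Function.HasTemperateGrowth (fun s => s ^ 2 + β s)
    fun_prop
  have hms : ∀ s, s ^ 2 ≤ m s := fun s => by
    have := β.nonneg (x := s)
    simp only [m]; linarith
  have hm1 : ∀ s, 1 ≤ m s := by
    intro s
    by_cases h : |s| ≤ 1
    · have : β s = 1 := β.one_of_mem_closedBall (by simpa [β] using h)
      simp only [m, this]; nlinarith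
    · have : 1 < |s| := not_le.1 h
      refine le_trans ?_ (hms s)
      rw [← sq_abs]; nlinarith
  have hq : ∀ x : ℝ, 0 ≤ x → (x ^ (1/4:ℝ)) ^ 2 = √x := by
    intro x hx
    rw [← Real.rpow_natCast, ← Real.rpow_mul hx, Real.sqrt_eq_rpow]; norm_num
  refine ⟨_, temperate_rpow_quarter hm hm1, ?_, ?_⟩
  · intro s hs
    have : β s = 0 := β.zero_of_le_dist (by simp only [β, dist_zero_right, Real.norm_eq_abs]; exact hs.trans (le_abs_self s))
    have h2 : m s = s ^ 2 := by simp [m, this]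
    show (m s) ^ (1/4:ℝ) = _
    rw [h2, ← Real.rpow_natCast, ← Real.rpow_mul (by linarith), Real.sqrt_eq_rpow]; norm_num
  · intro s
    show |s| ≤ ((m s) ^ (1/4:ℝ)) ^ 2
    rw [hq _ (by linarith [hm1 s]), ← Real.sqrt_sq_eq_abs]
    exact Real.sqrt_le_sqrt (hms s)

/-- entire function `C` with `C (y^2) = cos y` -/
lemma exists_cosSqrt : ∃ C : ℝ → ℝ, ContDiff ℝ ∞ C ∧ ∀ y, C (y ^ 2) = Real.cos y := by
  let c : ℕ → ℝ := fun n => (-1) ^ n / (2 * n).factorial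
  have hrad : (FormalMultilinearSeries.ofScalars ℝ c).radius = ⊤ := by
    apply FormalMultilinearSeries.ofScalars_radius_eq_top_of_tendsto
    · exact Filter.Eventually.of_forall fun n => by simp only [c]; positivity
    · have : ∀ n : ℕ, ‖c n.succ‖ / ‖c n‖ ≤ 1 / ((n : ℝ) + 1) := by
        intro n
        have e : (2 * n.succ).factorial = (2 * n + 2) * ((2 * n + 1) * (2 * n).factorial) := by
          rw [Nat.mul_succ, Nat.factorial_succ, Nat.factorial_succ]
        simp only [c, norm_div, norm_pow, norm_neg, norm_one, one_pow, e]
        have : (0:ℝ) < (2 * n).factorial := by positivity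
        push_cast
        simp only [norm_mul, Real.norm_natCast]
        rw [Real.norm_of_nonneg (by positivity), Real.norm_of_nonneg (by positivity)]
        have hn : (0:ℝ) ≤ n := by positivity
        rw [div_div_eq_mul_div, div_one, one_div_mul_eq_div, div_le_div_iff₀ (by positivity) (by positivity)]
        have := mul_nonneg hn this.le
        nlinarith [mul_nonneg hn this]
      refine squeeze_zero (fun n => by positivity) this ?_
      exact tendsto_one_div_add_atTop_nhds_zero_nat
  refine ⟨FormalMultilinearSeries.ofScalarsSum c, ?_, fun y => ?_⟩
  · have h := (FormalMultilinearSeries.ofScalars ℝ c).hasFPowerSeriesOnBall (by rw [hrad]; simp)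
    rw [hrad] at h
    have h2 : AnalyticOnNhd ℝ (FormalMultilinearSeries.ofScalars ℝ c).sum Set.univ := by
      have := h.analyticOnNhd
      simpa using this
    have h3 : ContDiffOn ℝ ∞ (FormalMultilinearSeries.ofScalars ℝ c).sum Set.univ := h2.contDiffOn uniqueDiffOn_univ
    exact contDiffOn_univ.1 h3
  · rw [FormalMultilinearSeries.ofScalars_sum_eq, ← (Real.hasSum_cos y).tsum_eq]
    congr 1 with n
    simp only [c, smul_eq_mul, ← pow_mul]; ring

lemma temperate_cos : Function.HasTemperateGrowth Real.cos := by
  refine ⟨Real.contDiff_cos, fun n => ⟨0, 1, fun x => ?_⟩⟩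
  rw [norm_iteratedFDeriv_eq_norm_iteratedDeriv]
  simpa using Real.abs_iteratedDeriv_cos_le_one n x

lemma exists_temperate_cosSqrt : ∃ c : ℝ → ℝ, c.HasTemperateGrowth ∧ ∀ y, c (y ^ 2) = Real.cos y := by
  obtain ⟨r, hr, hr2, -⟩ := exists_smooth_root
  obtain ⟨C, hC, hC2⟩ := exists_cosSqrt
  let α : ContDiffBump (0:ℝ) := ⟨2, 3, by norm_num, by norm_num⟩
  have hα : Function.HasTemperateGrowth (α : ℝ → ℝ) :=
    α.hasCompactSupport.hasTemperateGrowth α.contDiff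
  have h1 : Function.HasTemperateGrowth (fun u => α u * C u) :=
    (α.hasCompactSupport.mul_right).hasTemperateGrowth (α.contDiff.mul hC)
  have h2 : Function.HasTemperateGrowth (fun u => Real.cos (r u)) := temperate_cos.comp hr
  refine ⟨fun u => α u * C u + (1 - α u) * Real.cos (r u), by fun_prop, fun y => ?_⟩
  simp only [hC2]
  rcases le_total 2 (y ^ 2) with h | h
  · rw [hr2 _ h, Real.sqrt_sq_eq_abs, Real.cos_abs]; ring
  · have : α (y ^ 2) = 1 := α.one_of_mem_closedBall (by
      simp only [α, Metric.mem_closedBall, dist_zero_right, Real.norm_eq_abs, abs_of_nonneg (sq_nonneg y)]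
      exact h)
    rw [this]; ring

end Whitney

section Whitney2

lemma temperate_prodMk {X W U : Type} [NormedAddCommGroup X] [NormedSpace ℝ X]
    [NormedAddCommGroup W] [NormedSpace ℝ W] [NormedAddCommGroup U] [NormedSpace ℝ U]
    {f : X → W} {g : X → U} (hf : f.HasTemperateGrowth) (hg : g.HasTemperateGrowth) :
    Function.HasTemperateGrowth (fun x => (f x, g x)) := by
  have h1 := (ContinuousLinearMap.inl ℝ W U).hasTemperateGrowth.comp hf
  have h2 := (ContinuousLinearMap.inr ℝ W U).hasTemperateGrowth.comp hg
  have h3 := h1.add h2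
  convert! h3 using 1
  ext x <;> simp

lemma cos_formula {h : 𝓢(ℝ, ℂ)} (hev : ∀ z, h (-z) = h z) (z : ℝ) :
    h z = ∫ y, 𝓕 (h : ℝ → ℂ) y * (Real.cos (2 * π * y * z) : ℂ) := by
  have e : ∀ z, h z = ∫ y, Complex.exp (↑(2 * π * y * z) * I) • 𝓕 (h : ℝ → ℂ) y := by
    intro z
    have h1 : 𝓕⁻ (𝓕 (h : ℝ → ℂ)) z = h z := by
      have := FourierTransform.fourierInv_fourier_eq (F := 𝓢(ℝ, ℂ)) h
      have h2 := congrArg (fun f : 𝓢(ℝ, ℂ) => f z) this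
      simpa only [SchwartzMap.fourierInv_coe, SchwartzMap.fourier_coe] using h2
    rw [← h1, Real.fourierInv_eq']
    simp only [RCLike.inner_apply, conj_trivial]
    congr 1 with y
    congr 4
    ring
  have hint : ∀ z : ℝ, Integrable (fun y : ℝ => Complex.exp (↑(2 * π * y * z) * I) • 𝓕 (h : ℝ → ℂ) y) := by
    intro z
    have hI : Integrable (𝓕 (h : ℝ → ℂ)) := by
      rw [← SchwartzMap.fourier_coe]; exact SchwartzMap.integrable _
    refine hI.bdd_mul (c := 1) (by fun_prop) (Filter.Eventually.of_forall fun y => ?_)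
    rw [Complex.norm_exp_ofReal_mul_I]
  have e2 : h z = (1/2 : ℂ) * (h z + h (-z)) := by rw [hev]; ring
  rw [e2, e z, e (-z), ← integral_add (hint _) (hint _), ← integral_const_mul]
  congr 1 with y
  rw [Complex.ofReal_cos, Complex.cos]
  push_cast
  simp only [smul_eq_mul, mul_neg, neg_mul]
  ring

lemma whitney {V : Type} [NormedAddCommGroup V] [NormedSpace ℝ V] (ψ0 : 𝓢(V × ℝ, ℂ))
    (hev : ∀ k z, ψ0 (k, -z) = ψ0 (k, z)) :
    ∃ Φ : 𝓢(V × ℝ, ℂ), ∀ k z, Φ (k, z ^ 2) = ψ0 (k, z) := by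
  obtain ⟨r, hr, hr2, hr3⟩ := exists_smooth_root
  obtain ⟨c, hc, hc2⟩ := exists_temperate_cosSqrt
  obtain ⟨ψ, hψ⟩ := exists_partialFourier ψ0
  let α : ContDiffBump (0:ℝ) := ⟨2, 3, by norm_num, by norm_num⟩
  have hα : Function.HasTemperateGrowth (α : ℝ → ℝ) :=
    α.hasCompactSupport.hasTemperateGrowth α.contDiff
  have hαc : HasCompactSupport (fun s => (α s : ℂ)) :=
    α.hasCompactSupport.comp_left (g := fun x : ℝ => (x : ℂ)) (by simp)
  have hαd : ContDiff ℝ ∞ (fun s => (α s : ℂ)) := Complex.ofRealCLM.contDiff.comp α.contDiff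
  let a : 𝓢(ℝ, ℂ) := hαc.toSchwartzMap hαd
  obtain ⟨H0, hH0⟩ := exists_tensor a ψ
    ((ContinuousLinearMap.snd ℝ V ℝ).comp (ContinuousLinearMap.fst ℝ (V × ℝ) ℝ))
    (((ContinuousLinearMap.fst ℝ V ℝ).comp (ContinuousLinearMap.fst ℝ (V × ℝ) ℝ)).prod
      (ContinuousLinearMap.snd ℝ (V × ℝ) ℝ)) (by
        rintro ⟨⟨k, s⟩, y⟩
        simp only [ContinuousLinearMap.prod_apply, ContinuousLinearMap.comp_apply,
          ContinuousLinearMap.coe_fst', ContinuousLinearMap.coe_snd', Prod.norm_mk]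
        have h1 := norm_nonneg s
        have h2 := norm_nonneg k
        have h3 := norm_nonneg y
        have h4 : max (max ‖k‖ ‖s‖) ‖y‖ ≤ ‖s‖ + max ‖k‖ ‖y‖ := by
          refine max_le (max_le ?_ ?_) ?_
          · linarith [le_max_left ‖k‖ ‖y‖]
          · linarith [le_max_left ‖k‖ ‖y‖]
          · linarith [le_max_right ‖k‖ ‖y‖]
        nlinarith [mul_nonneg h1 (h2.trans (le_max_left ‖k‖ ‖y‖))])
  have ht : Function.HasTemperateGrowth (fun x : (V × ℝ) × ℝ => c (4 * π ^ 2 * x.2 ^ 2 * x.1.2)) := by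
    refine hc.comp ?_
    have e2 : Function.HasTemperateGrowth (fun x : (V × ℝ) × ℝ => x.2) :=
      (ContinuousLinearMap.snd ℝ (V × ℝ) ℝ).hasTemperateGrowth
    have e1 : Function.HasTemperateGrowth (fun x : (V × ℝ) × ℝ => x.1.2) :=
      ((ContinuousLinearMap.snd ℝ V ℝ).comp (ContinuousLinearMap.fst ℝ (V × ℝ) ℝ)).hasTemperateGrowth
    fun_prop
  obtain ⟨Φ1, hΦ1⟩ := exists_partialIntegral (SchwartzMap.smulLeftCLM ℂ (fun x : (V × ℝ) × ℝ => c (4 * π ^ 2 * x.2 ^ 2 * x.1.2)) H0)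
  have f1 : Function.HasTemperateGrowth (fun x : V × ℝ => x.1) :=
      (ContinuousLinearMap.fst ℝ V ℝ).hasTemperateGrowth
  have f2 : Function.HasTemperateGrowth (fun x : V × ℝ => x.2) :=
      (ContinuousLinearMap.snd ℝ V ℝ).hasTemperateGrowth
  have hg : Function.HasTemperateGrowth (fun x : V × ℝ => (x.1, r x.2)) := temperate_prodMk f1 (hr.comp f2)
  have hg2 : ∃ (k : ℕ) (C : ℝ), ∀ x : V × ℝ, ‖x‖ ≤ C * (1 + ‖(x.1, r x.2)‖) ^ k := by
    refine ⟨2, 1, ?_⟩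
    rintro ⟨k, s⟩
    simp only [Prod.norm_mk, one_mul]
    have h0 := norm_nonneg k
    have h1 := le_max_left ‖k‖ ‖r s‖
    have h2 := le_max_right ‖k‖ ‖r s‖
    have h3 := norm_nonneg (r s)
    refine max_le ?_ ?_
    · nlinarith
    · have := hr3 s
      rw [← sq_abs, ← Real.norm_eq_abs, ← Real.norm_eq_abs] at this
      nlinarith
  let Φ2 := SchwartzMap.smulLeftCLM ℂ (fun x : V × ℝ => 1 - α x.2) (SchwartzMap.compCLM ℝ hg hg2 ψ0)
  have hΦ2 : ∀ k s, Φ2 (k, s) = (1 - α s : ℝ) • ψ0 (k, r s) := by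
    intro k s
    have : Function.HasTemperateGrowth (fun x : V × ℝ => 1 - α x.2) := by
      have := hα.comp f2
      have h1 : Function.HasTemperateGrowth (fun x : V × ℝ => (1:ℝ)) := by fun_prop
      exact h1.sub this
    simp only [Φ2]
    rw [SchwartzMap.smulLeftCLM_apply_apply this]
    rfl
  refine ⟨Φ1 + Φ2, fun k z => ?_⟩
  rw [add_apply, hΦ2, hΦ1]
  have e1 : ∫ y, SchwartzMap.smulLeftCLM ℂ (fun x : (V × ℝ) × ℝ => c (4 * π ^ 2 * x.2 ^ 2 * x.1.2)) H0
      ((k, z ^ 2), y) = α (z ^ 2) * ψ0 (k, z) := by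
    obtain ⟨h, hh⟩ := exists_slice ψ0 k
    have hfun : (h : ℝ → ℂ) = fun y => ψ0 (k, y) := funext hh
    rw [← hh z, cos_formula (h := h) (fun z => by rw [hh, hh, hev]) z, ← integral_const_mul]
    congr 1 with y
    rw [SchwartzMap.smulLeftCLM_apply_apply ht, hH0]
    have : 4 * π ^ 2 * y ^ 2 * z ^ 2 = (2 * π * y * z) ^ 2 := by ring
    simp only [this, hc2]
    have e3 : ψ (k, y) = 𝓕 (h : ℝ → ℂ) y := by rw [hψ, hfun]
    simp only [ContinuousLinearMap.prod_apply, ContinuousLinearMap.comp_apply,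
          ContinuousLinearMap.coe_fst', ContinuousLinearMap.coe_snd', e3, real_smul]
    have : a (z ^ 2) = α (z ^ 2) := rfl
    rw [this]; ring
  rw [e1]
  rcases le_total 2 (z ^ 2) with h | h
  · rw [hr2 _ h, Real.sqrt_sq_eq_abs]
    have : ψ0 (k, |z|) = ψ0 (k, z) := by
      rcases abs_choice z with h | h <;> rw [h]
      rw [hev]
    rw [this, real_smul]; push_cast; ring
  · have : α (z ^ 2) = 1 := α.one_of_mem_closedBall (by
      simp only [α, Metric.mem_closedBall, dist_zero_right, Real.norm_eq_abs, abs_of_nonneg (sq_nonneg z)]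
      exact h)
    rw [this]; simp

end Whitney2

section Radial

section withLp
variable {U V F : Type} [NormedAddCommGroup U] [InnerProductSpace ℝ U] [MeasurableSpace U]
  [BorelSpace U] [FiniteDimensional ℝ U] [NormedAddCommGroup V] [InnerProductSpace ℝ V]
  [MeasurableSpace V] [BorelSpace V] [FiniteDimensional ℝ V] [NormedAddCommGroup F]

lemma integral_withLp [NormedSpace ℝ F] (f : WithLp 2 (U × V) → F) :
    ∫ x, f x = ∫ p : U × V, f (WithLp.toLp 2 p) :=
  ((WithLp.volume_preserving_toLp U V).integral_comp
    (MeasurableEquiv.toLp 2 (U × V)).measurableEmbedding f).symm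

lemma integrable_withLp (f : WithLp 2 (U × V) → F) :
    Integrable (fun p : U × V => f (WithLp.toLp 2 p)) ↔ Integrable f :=
  ((WithLp.volume_preserving_toLp U V).integrable_comp_emb
    (MeasurableEquiv.toLp 2 (U × V)).measurableEmbedding)
end withLp

/-- primitive of an odd Schwartz function -/
lemma tail_props (f : 𝓢(ℝ, ℂ)) (hodd : ∀ t, f (-t) = - f t) :
    ∃ A : ℝ → ℂ, (∀ z, HasDerivAt A (- f z) z) ∧ (∀ z, A |z| = A z) ∧
      Filter.Tendsto A Filter.atTop (nhds 0) := by
  have hi : Integrable (f : ℝ → ℂ) := f.integrable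
  have hc : Continuous (f : ℝ → ℂ) := f.continuous
  refine ⟨fun z => (∫ t in Set.Ioi 0, f t) - ∫ t in (0:ℝ)..z, f t, fun z => ?_, fun z => ?_, ?_⟩
  · have := (intervalIntegral.integral_hasDerivAt_right (hc.intervalIntegrable 0 z)
      (hc.stronglyMeasurableAtFilter _ _) hc.continuousAt).const_sub (∫ t in Set.Ioi 0, f t)
    exact this
  · rcases abs_choice z with h | h <;> rw [h]
    beta_reduce
    congr 1
    have h1 := intervalIntegral.integral_comp_neg (fun t => f t) (a := 0) (b := z)
    simp only [hodd, neg_zero] at h1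
    rw [intervalIntegral.integral_neg] at h1
    rw [intervalIntegral.integral_symm, ← h1, neg_neg]
  · have := intervalIntegral_tendsto_integral_Ioi 0 hi.integrableOn (Filter.tendsto_id (α := ℝ))
    simpa using this.const_sub (∫ t in Set.Ioi 0, f t)

lemma plane_integral (f : 𝓢(ℝ, ℂ)) (A : ℝ → ℂ) (hA : ∀ z, HasDerivAt A (- f z) z)
    (hA2 : ∀ z, A |z| = A z) (hA3 : Filter.Tendsto A Filter.atTop (nhds 0)) (z : ℝ)
    (hi : Integrable (fun η : EuclideanSpace ℝ (Fin 2) =>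
      f (√(‖η‖ ^ 2 + z ^ 2)) / (√(‖η‖ ^ 2 + z ^ 2) : ℝ))) :
    ∫ η : EuclideanSpace ℝ (Fin 2), f (√(‖η‖ ^ 2 + z ^ 2)) / (√(‖η‖ ^ 2 + z ^ 2) : ℝ)
      = 2 * π * A z := by
  have h1 := integral_fun_norm_addHaar (volume : Measure (EuclideanSpace ℝ (Fin 2)))
    (fun r : ℝ => f (√(r ^ 2 + z ^ 2)) / (√(r ^ 2 + z ^ 2) : ℝ))
  have h2 := (integrable_fun_norm_addHaar (volume : Measure (EuclideanSpace ℝ (Fin 2)))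
    (f := fun r : ℝ => f (√(r ^ 2 + z ^ 2)) / (√(r ^ 2 + z ^ 2) : ℝ))).1 hi
  have hvol : (volume : Measure (EuclideanSpace ℝ (Fin 2))).real (Metric.ball 0 1) = π := by
    rw [measureReal_def, EuclideanSpace.volume_ball_fin_two]
    simp [Real.pi_nonneg]
  simp only [finrank_euclideanSpace, Fintype.card_fin, hvol] at h1 h2
  have hs : ∀ r ∈ Set.Ioi (0:ℝ), HasDerivAt (fun r => - A (√(r ^ 2 + z ^ 2)))
      (r ^ (2 - 1) • (f (√(r ^ 2 + z ^ 2)) / (√(r ^ 2 + z ^ 2) : ℝ))) r := by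
    intro r hr
    have hr : 0 < r := hr
    have hp : 0 < r ^ 2 + z ^ 2 := by positivity
    have d1 : HasDerivAt (fun r : ℝ => √(r ^ 2 + z ^ 2)) (2 * r / (2 * √(r ^ 2 + z ^ 2))) r := by
      have := ((hasDerivAt_pow 2 r).add_const (z ^ 2)).sqrt hp.ne'
      simpa using this
    have d2 := ((hA (√(r ^ 2 + z ^ 2))).scomp r d1).neg
    convert! d2 using 1
    have : (√(r ^ 2 + z ^ 2) : ℂ) ≠ 0 := by
      have := (Real.sqrt_pos.2 hp).ne'
      exact_mod_cast this
    simp only [real_smul]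
    push_cast
    field_simp
  have h3 := integral_Ioi_of_hasDerivAt_of_tendsto (m := 0) (a := 0)
    (f := fun r => - A (√(r ^ 2 + z ^ 2))) ?_ hs h2 ?_
  · rw [h1, h3]
    simp [Real.sqrt_sq_eq_abs, hA2, mul_assoc]
  · have hAc : Continuous A := continuous_iff_continuousAt.2 fun z => (hA z).continuousAt
    apply Continuous.continuousWithinAt
    fun_prop
  · have ht : Filter.Tendsto (fun r : ℝ => √(r ^ 2 + z ^ 2)) Filter.atTop Filter.atTop := by
      refine Filter.tendsto_atTop_mono (fun r => ?_) Filter.tendsto_id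
      exact Real.le_sqrt_of_sq_le (by simp only [id]; nlinarith [sq_nonneg z])
    simpa using (hA3.comp ht).neg

set_option maxHeartbeats 1000000 in
lemma radial_fourier (f : 𝓢(ℝ, ℂ)) (hodd : ∀ t, f (-t) = - f t)
    (hi : Integrable (fun y : WithLp 2 (EuclideanSpace ℝ (Fin 2) × ℝ) => f ‖y‖ / (‖y‖ : ℂ)))
    (κ : WithLp 2 (EuclideanSpace ℝ (Fin 2) × ℝ)) :
    I * ‖κ‖ * 𝓕 (fun y : WithLp 2 (EuclideanSpace ℝ (Fin 2) × ℝ) => f ‖y‖ / (‖y‖ : ℂ)) κ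
      = - 𝓕 (f : ℝ → ℂ) ‖κ‖ := by
  obtain ⟨A, hA, hA2, hA3⟩ := tail_props f hodd
  set F : WithLp 2 (EuclideanSpace ℝ (Fin 2) × ℝ) → ℂ := fun y => f ‖y‖ / (‖y‖ : ℂ) with hF
  let e : WithLp 2 (EuclideanSpace ℝ (Fin 2) × ℝ) := WithLp.toLp 2 (0, ‖κ‖)
  have hnorm : ∀ η : EuclideanSpace ℝ (Fin 2), ∀ z : ℝ,
      ‖(WithLp.toLp 2 (η, z) : WithLp 2 (EuclideanSpace ℝ (Fin 2) × ℝ))‖ = √(‖η‖ ^ 2 + z ^ 2) := by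
    intro η z
    rw [WithLp.prod_norm_eq_of_L2]
    simp
  have he : ‖κ‖ = ‖e‖ := by
    simp only [e]
    rw [hnorm 0 ‖κ‖]
    simp only [norm_zero, ne_eq, OfNat.ofNat_ne_zero, not_false_eq_true, zero_pow, zero_add, Real.sqrt_sq (norm_nonneg _)]
  have h1 : 𝓕 F κ = 𝓕 F e := by
    have h := Real.fourier_comp_linearIsometry ((ℝ ∙ (κ - e))ᗮ.reflection) F κ
    rw [Submodule.reflection_sub he] at h
    rw [← h]
    have : F ∘ ((ℝ ∙ (κ - e))ᗮ.reflection) = F := by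
      funext y
      simp only [hF, Function.comp, LinearIsometryEquiv.norm_map]
    rw [this]
  have hi2 : Integrable (fun p : EuclideanSpace ℝ (Fin 2) × ℝ =>
      f (√(‖p.1‖ ^ 2 + p.2 ^ 2)) / (√(‖p.1‖ ^ 2 + p.2 ^ 2) : ℝ)) := by
    have := (integrable_withLp _).2 hi
    refine this.congr (Filter.Eventually.of_forall fun p => ?_)
    rcases p with ⟨η, z⟩
    simp only [hF, hnorm]
  have hae : ∀ᵐ z : ℝ, ∫ η : EuclideanSpace ℝ (Fin 2),
      f (√(‖η‖ ^ 2 + z ^ 2)) / (√(‖η‖ ^ 2 + z ^ 2) : ℝ) = 2 * π * A z := by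
    filter_upwards [hi2.prod_left_ae] with z hz
    exact plane_integral f A hA hA2 hA3 z hz
  have hAi : Integrable A := by
    have h := (hi2.integral_prod_right).congr hae
    have := h.const_mul (2 * π : ℂ)⁻¹
    refine this.congr (Filter.Eventually.of_forall fun z => ?_)
    have : (2 * π : ℂ) ≠ 0 := by simp [Real.pi_ne_zero]
    simp only
    rw [inv_mul_cancel_left₀ this]
  have hd : deriv A = fun z => - f z := funext fun z => (hA z).deriv
  have h2 := congrFun (Real.fourier_deriv hAi (fun z => (hA z).differentiableAt)
    (by rw [hd]; exact f.integrable.neg)) ‖κ‖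
  have h2' : 𝓕 (deriv A) ‖κ‖ = - 𝓕 (f : ℝ → ℂ) ‖κ‖ := by
    rw [hd, Real.fourier_eq', Real.fourier_eq']
    simp [integral_neg]
  have h3 : 𝓕 F e = 2 * π * 𝓕 A ‖κ‖ := by
    rw [Real.fourier_eq', integral_withLp, Real.fourier_eq', ← integral_const_mul]
    have hint : Integrable (fun p : EuclideanSpace ℝ (Fin 2) × ℝ =>
        cexp (↑(-2 * π * (p.2 * ‖κ‖)) * I) *
        (f (√(‖p.1‖ ^ 2 + p.2 ^ 2)) / (√(‖p.1‖ ^ 2 + p.2 ^ 2) : ℝ))) := by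
      refine hi2.bdd_mul (c := 1) (by fun_prop) (Filter.Eventually.of_forall fun y => ?_)
      rw [Complex.norm_exp_ofReal_mul_I]
    have h4 := integral_prod_symm _ hint
    calc _ = _ := by
          congr 1 with p
          rcases p with ⟨η, z⟩
          simp only [hF, hnorm, e, WithLp.prod_inner_apply, smul_eq_mul]
          simp [mul_comm]
      _ = _ := h4
      _ = _ := by
          refine integral_congr_ae ?_
          filter_upwards [hae] with z hz
          rw [integral_const_mul, hz]
          simp [mul_comm, mul_assoc, mul_left_comm]
  rw [h1, h3, ← h2', h2, smul_eq_mul]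
  ring

end Radial

section Backproj

/-- the observation plane -/
abbrev Pl : Type := EuclideanSpace ℝ (Fin 2)

/-- Euclidean three-space as an orthogonal sum -/
abbrev Sp : Type := WithLp 2 (Pl × ℝ)

lemma odd_bound (g : 𝓢(ℝ × Pl, ℂ)) (hodd : ∀ t ξ, g (-t, ξ) = - g (t, ξ)) :
    ∃ C, 0 ≤ C ∧ ∀ t ξ, ‖g (t, ξ) / (t : ℂ)‖ ≤ C * ((1 + ‖ξ‖) ^ 3)⁻¹ * ((1 + |t|) ^ 4)⁻¹ := by
  obtain ⟨C0, h0⟩ : ∃ C, ∀ y : ℝ × Pl, (1 + ‖y‖) ^ 7 * ‖g y‖ ≤ C := by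
    have h := SchwartzMap.one_add_le_sup_seminorm_apply (𝕜 := ℝ) (m := (7, 0)) (k := 7) (n := 0)
      le_rfl le_rfl g
    simp only [norm_iteratedFDeriv_zero] at h
    exact ⟨_, h⟩
  obtain ⟨C1, h1⟩ : ∃ C, ∀ y : ℝ × Pl, (1 + ‖y‖) ^ 7 * ‖fderiv ℝ g y‖ ≤ C := by
    have h := SchwartzMap.one_add_le_sup_seminorm_apply (𝕜 := ℝ) (m := (7, 1)) (k := 7) (n := 1)
      le_rfl le_rfl g
    simp only [norm_iteratedFDeriv_one] at h
    exact ⟨_, h⟩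
  have hC0 : 0 ≤ C0 := le_trans (by positivity) (h0 0)
  have hC1 : 0 ≤ C1 := le_trans (by positivity) (h1 0)
  have hz : ∀ ξ, g (0, ξ) = 0 := by
    intro ξ
    have := hodd 0 ξ
    rw [neg_zero] at this
    exact self_eq_neg.1 this
  refine ⟨C0 + 16 * C1, by positivity, fun t ξ => ?_⟩
  have hξ := norm_nonneg ξ
  have ht := abs_nonneg t
  rw [← mul_inv_le_iff₀ (by positivity), ← mul_inv_le_iff₀ (by positivity), inv_inv, inv_inv]
  rcases le_total |t| 1 with h | h
  · have hd : ∀ s ∈ Set.Icc (-1:ℝ) 1, HasDerivWithinAt (fun s : ℝ => g (s, ξ))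
        (fderiv ℝ g (s, ξ) (1, 0)) (Set.Icc (-1:ℝ) 1) s := by
      intro s _
      have h1 : HasDerivAt (fun s : ℝ => (s, ξ)) ((1:ℝ), (0 : Pl)) s :=
        (hasDerivAt_id s).prodMk (hasDerivAt_const s ξ)
      exact (g.differentiableAt.hasFDerivAt.comp_hasDerivAt s h1).hasDerivWithinAt
    have hb : ∀ s ∈ Set.Icc (-1:ℝ) 1, ‖fderiv ℝ g (s, ξ) (1, 0)‖ ≤ C1 * ((1 + ‖ξ‖) ^ 7)⁻¹ := by
      intro s _
      have e1 : ‖fderiv ℝ g (s, ξ) (1, 0)‖ ≤ ‖fderiv ℝ g (s, ξ)‖ := by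
        refine (ContinuousLinearMap.le_opNorm _ _).trans ?_
        simp [Prod.norm_mk]
      refine e1.trans ?_
      rw [← div_eq_mul_inv, le_div_iff₀ (by positivity), mul_comm]
      refine le_trans ?_ (h1 (s, ξ))
      gcongr
      exact le_max_right _ _
    have := (convex_Icc (-1:ℝ) 1).norm_image_sub_le_of_norm_hasDerivWithin_le hd hb
      (x := 0) (y := t) (by simp) (abs_le.1 h)
    simp only [hz, sub_zero] at this
    rw [← div_eq_mul_inv C1, div_mul_eq_mul_div, le_div_iff₀ (by positivity), Real.norm_eq_abs] at this
    rcases eq_or_ne t 0 with rfl | ht0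
    · simp; positivity
    have htp : 0 < |t| := abs_pos.2 ht0
    rw [norm_div, Complex.norm_real, Real.norm_eq_abs, div_mul_eq_mul_div, div_mul_eq_mul_div, div_le_iff₀ htp]
    have e3 : (1 + ‖ξ‖) ^ 3 ≤ (1 + ‖ξ‖) ^ 7 := pow_le_pow_right₀ (by linarith) (by norm_num)
    have e4 : (1 + |t|) ^ 4 ≤ 16 := by
      calc (1 + |t|) ^ 4 ≤ (1 + 1) ^ 4 := by gcongr
        _ = 16 := by norm_num
    calc ‖g (t, ξ)‖ * (1 + |t|) ^ 4 * (1 + ‖ξ‖) ^ 3 ≤ ‖g (t, ξ)‖ * 16 * (1 + ‖ξ‖) ^ 7 := by gcongr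
      _ ≤ 16 * (C1 * |t|) := by linarith
      _ ≤ _ := by nlinarith [mul_nonneg hC0 ht]
  · have h2 : ‖g (t, ξ) / (t : ℂ)‖ ≤ ‖g (t, ξ)‖ := by
      rw [norm_div, Complex.norm_real, Real.norm_eq_abs]
      exact div_le_self (norm_nonneg _) h
    have e1 : |t| ≤ ‖(t, ξ)‖ := le_max_left _ _
    have e2 : ‖ξ‖ ≤ ‖(t, ξ)‖ := le_max_right _ _
    calc ‖g (t, ξ) / (t : ℂ)‖ * (1 + |t|) ^ 4 * (1 + ‖ξ‖) ^ 3
        ≤ ‖g (t, ξ)‖ * (1 + ‖(t, ξ)‖) ^ 4 * (1 + ‖(t, ξ)‖) ^ 3 := by gcongr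
      _ = (1 + ‖(t, ξ)‖) ^ 7 * ‖g (t, ξ)‖ := by ring
      _ ≤ C0 := h0 _
      _ ≤ _ := by linarith

/-- embedding of the plane -/
noncomputable def iot (ξ : Pl) : Sp := WithLp.toLp 2 (ξ, 0)

lemma continuous_iot : Continuous iot := by
  unfold iot
  exact (WithLp.prod_continuous_toLp 2 Pl ℝ).comp (by fun_prop)

/-- backprojection kernel -/
noncomputable def Kern (g : 𝓢(ℝ × Pl, ℂ)) (p : Sp × Pl) : ℂ :=
  g (‖p.1 - iot p.2‖, p.2) / (‖p.1 - iot p.2‖ : ℂ)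

lemma measurable_Kern (g : 𝓢(ℝ × Pl, ℂ)) : Measurable (Kern g) := by
  have hc : Continuous (fun p : Sp × Pl => ‖p.1 - iot p.2‖) := by
    have := continuous_iot
    fun_prop
  have h1 : Measurable (fun p : Sp × Pl => g (‖p.1 - iot p.2‖, p.2)) :=
    (g.continuous.comp (hc.prodMk continuous_snd)).measurable
  have h2 : Measurable (fun p : Sp × Pl => (‖p.1 - iot p.2‖ : ℂ)) :=
    (Complex.continuous_ofReal.comp hc).measurable
  exact h1.div h2

lemma integrable_pl : Integrable (fun ξ : Pl => ((1 + ‖ξ‖) ^ 3)⁻¹) := by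
  have := integrable_one_add_norm (E := Pl) (μ := volume) (r := 3) (by simp; norm_num)
  refine this.congr (Filter.Eventually.of_forall fun ξ => ?_)
  have h0 : 0 ≤ 1 + ‖ξ‖ := by positivity
  simp only
  rw [Real.rpow_neg h0]
  norm_cast

lemma finrank_sp : Module.finrank ℝ Sp = 3 := by
  rw [(WithLp.linearEquiv 2 ℝ (Pl × ℝ)).finrank_eq]
  simp

lemma integrable_sp : Integrable (fun y : Sp => ((1 + ‖y‖) ^ 4)⁻¹) := by
  have := integrable_one_add_norm (E := Sp) (μ := volume) (r := 4) (by rw [finrank_sp]; norm_num)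
  refine this.congr (Filter.Eventually.of_forall fun ξ => ?_)
  have h0 : 0 ≤ 1 + ‖ξ‖ := by positivity
  simp only
  rw [Real.rpow_neg h0]
  norm_cast

lemma integrable_radial (g : 𝓢(ℝ × Pl, ℂ)) (hodd : ∀ t ξ, g (-t, ξ) = - g (t, ξ)) (ξ : Pl) :
    Integrable (fun y : Sp => g (‖y‖, ξ) / (‖y‖ : ℂ)) := by
  obtain ⟨C, hC, hb⟩ := odd_bound g hodd
  refine (integrable_sp.const_mul (C * ((1 + ‖ξ‖) ^ 3)⁻¹)).mono' ?_ (Filter.Eventually.of_forall fun y => ?_)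
  · have h1 : Measurable (fun p : Sp => g (‖p‖, ξ)) :=
      (g.continuous.comp (by fun_prop : Continuous fun p : Sp => (‖p‖, ξ))).measurable
    have h2 : Measurable (fun p : Sp => (‖p‖ : ℂ)) := by fun_prop
    exact (h1.div h2).aestronglyMeasurable
  · have := hb ‖y‖ ξ
    rwa [abs_norm] at this

lemma integrable_Kern (g : 𝓢(ℝ × Pl, ℂ)) (hodd : ∀ t ξ, g (-t, ξ) = - g (t, ξ)) :
    Integrable (Kern g) := by
  obtain ⟨C, hC, hb⟩ := odd_bound g hodd
  have hm := (measurable_Kern g).aestronglyMeasurable (μ := (volume : Measure Sp).prod (volume : Measure Pl))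
  refine (integrable_prod_iff' hm).2 ⟨Filter.Eventually.of_forall fun ξ => ?_, ?_⟩
  · exact (integrable_radial g hodd ξ).comp_sub_right (iot ξ)
  · have e : ∀ ξ : Pl, ∫ x : Sp, ‖Kern g (x, ξ)‖ = ∫ y : Sp, ‖g (‖y‖, ξ) / (‖y‖ : ℂ)‖ := fun ξ =>
      integral_sub_right_eq_self (fun y : Sp => ‖g (‖y‖, ξ) / (‖y‖ : ℂ)‖) (iot ξ)
    refine (integrable_pl.const_mul (C * ∫ y : Sp, ((1 + ‖y‖) ^ 4)⁻¹)).mono'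
      hm.norm.prod_swap.integral_prod_right' (Filter.Eventually.of_forall fun ξ => ?_)
    have hnn : 0 ≤ ∫ x : Sp, ‖Kern g (x, ξ)‖ := integral_nonneg fun _ => norm_nonneg _
    rw [Real.norm_of_nonneg hnn, e]
    calc _ ≤ ∫ y : Sp, C * ((1 + ‖ξ‖) ^ 3)⁻¹ * ((1 + ‖y‖) ^ 4)⁻¹ := by
          refine integral_mono (integrable_radial g hodd ξ).norm (integrable_sp.const_mul _) fun y => ?_
          have := hb ‖y‖ ξ
          rwa [abs_norm] at this
      _ = _ := by rw [integral_const_mul]; ring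

lemma continuous_backproj (g : 𝓢(ℝ × Pl, ℂ)) (hodd : ∀ t ξ, g (-t, ξ) = - g (t, ξ)) :
    Continuous (fun x : Sp => ∫ ξ, Kern g (x, ξ)) := by
  obtain ⟨C, hC, hb⟩ := odd_bound g hodd
  refine continuous_iff_continuousAt.2 fun x0 => ?_
  refine continuousAt_of_dominated (bound := fun ξ => C * ((1 + ‖ξ‖) ^ 3)⁻¹) ?_ ?_
    (integrable_pl.const_mul _) ?_
  · exact Filter.Eventually.of_forall fun x =>
      ((measurable_Kern g).comp measurable_prodMk_left).aestronglyMeasurable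
  · refine Filter.Eventually.of_forall fun x => Filter.Eventually.of_forall fun ξ => ?_
    refine (hb _ _).trans ?_
    refine mul_le_of_le_one_right (by positivity) (inv_le_one_of_one_le₀ (one_le_pow₀ ?_))
    linarith [abs_nonneg ‖x - iot ξ‖]
  · have : ∀ᵐ ξ : Pl, ξ ≠ x0.fst := by
      rw [ae_iff]; simp
    filter_upwards [this] with ξ hξ
    have hne : x0 - iot ξ ≠ 0 := by
      intro h
      apply hξ
      rw [sub_eq_zero.1 h]
      rfl
    unfold Kern
    refine ContinuousAt.div ?_ ?_ ?_
    · exact (g.continuous.comp (by fun_prop : Continuous fun x : Sp => (‖x - iot ξ‖, ξ))).continuousAt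
    · exact (Complex.continuous_ofReal.comp (by fun_prop : Continuous fun x : Sp => ‖x - iot ξ‖)).continuousAt
    · simpa using hne

lemma fourier_backproj (g : 𝓢(ℝ × Pl, ℂ)) (hodd : ∀ t ξ, g (-t, ξ) = - g (t, ξ)) (κ : Sp) :
    I * ‖κ‖ * 𝓕 (fun x : Sp => ∫ ξ, Kern g (x, ξ)) κ =
      - ∫ ξ : Pl, cexp (↑(-2 * π * inner ℝ ξ κ.fst) * I) * 𝓕 (fun t : ℝ => g (t, ξ)) ‖κ‖ := by
  have hK := integrable_Kern g hodd
  have hint : Integrable (fun p : Sp × Pl => cexp (↑(-2 * π * inner ℝ p.1 κ) * I) * Kern g p) := by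
    refine hK.bdd_mul (c := 1) ?_ (Filter.Eventually.of_forall fun y => ?_)
    · have : Continuous (fun p : Sp × Pl => cexp (↑(-2 * π * inner ℝ p.1 κ) * I)) := by fun_prop
      exact this.aestronglyMeasurable
    · rw [Complex.norm_exp_ofReal_mul_I]
  have h1 : 𝓕 (fun x : Sp => ∫ ξ, Kern g (x, ξ)) κ
      = ∫ ξ : Pl, ∫ x : Sp, cexp (↑(-2 * π * inner ℝ x κ) * I) * Kern g (x, ξ) := by
    rw [Real.fourier_eq']
    rw [← integral_integral_swap (f := fun (x : Sp) (ξ : Pl) =>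
      cexp (↑(-2 * π * inner ℝ x κ) * I) * Kern g (x, ξ)) hint]
    congr 1 with x
    rw [smul_eq_mul, integral_const_mul]
  have h2 : ∀ ξ : Pl, ∫ x : Sp, cexp (↑(-2 * π * inner ℝ x κ) * I) * Kern g (x, ξ)
      = cexp (↑(-2 * π * inner ℝ ξ κ.fst) * I) * 𝓕 (fun y : Sp => g (‖y‖, ξ) / (‖y‖ : ℂ)) κ := by
    intro ξ
    rw [Real.fourier_eq', ← integral_const_mul]
    refine Eq.trans ?_ (integral_sub_right_eq_self _ (iot ξ))
    congr 1 with x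
    rw [smul_eq_mul, ← mul_assoc, ← Complex.exp_add]
    have : inner ℝ x κ = inner ℝ ξ κ.fst + inner ℝ (x - iot ξ) κ := by
      rw [inner_sub_left]
      have : inner ℝ (iot ξ) κ = inner ℝ ξ κ.fst := by
        rw [WithLp.prod_inner_apply]
        simp [iot]
      rw [this]; ring
    rw [this]
    unfold Kern
    congr 2
    push_cast
    ring
  rw [h1, ← integral_const_mul, ← integral_neg]
  congr 1 with ξ
  rw [h2]
  obtain ⟨f, hf⟩ : ∃ f : 𝓢(ℝ, ℂ), ∀ t, f t = g (t, ξ) := by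
    obtain ⟨f, hf⟩ := exists_slice (SchwartzMap.compCLMOfContinuousLinearEquiv ℝ
      (ContinuousLinearEquiv.prodComm ℝ Pl ℝ) g) ξ
    exact ⟨f, fun t => by rw [hf]; rfl⟩
  have hfe : (f : ℝ → ℂ) = fun t => g (t, ξ) := funext hf
  have h3 := radial_fourier f (fun t => by rw [hf, hf, hodd]) (by
    simp only [hf]; exact integrable_radial g hodd ξ) κ
  simp only [hfe] at h3
  rw [← mul_neg, ← h3]
  ring

lemma fourier_prod (g : 𝓢(ℝ × Pl, ℂ)) (ρ : ℝ) (k : Pl) :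
    𝓕 (fun y : WithLp 2 (ℝ × Pl) => g y.ofLp) (WithLp.toLp 2 (ρ, k)) =
      ∫ ξ : Pl, cexp (↑(-2 * π * inner ℝ ξ k) * I) * 𝓕 (fun t : ℝ => g (t, ξ)) ρ := by
  rw [Real.fourier_eq', integral_withLp]
  have hgi : Integrable (g : ℝ × Pl → ℂ) :=
    (integrable_withLp (fun y : WithLp 2 (ℝ × Pl) => g y.ofLp)).2
      (SchwartzMap.compCLMOfContinuousLinearEquiv ℝ
        (WithLp.prodContinuousLinearEquiv 2 ℝ ℝ Pl) g).integrable
  have hint : Integrable (fun p : ℝ × Pl => cexp (↑(-2 * π * inner ℝ p.2 k) * I) *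
      (cexp (↑(-2 * π * (p.1 * ρ)) * I) * g p)) := by
    refine Integrable.bdd_mul (c := 1) (Integrable.bdd_mul (c := 1) hgi ?_
      (Filter.Eventually.of_forall fun y => ?_)) ?_ (Filter.Eventually.of_forall fun y => ?_)
    · have : Continuous (fun p : ℝ × Pl => cexp (↑(-2 * π * (p.1 * ρ)) * I)) := by fun_prop
      exact this.aestronglyMeasurable
    · rw [Complex.norm_exp_ofReal_mul_I]
    · have : Continuous (fun p : ℝ × Pl => cexp (↑(-2 * π * inner ℝ p.2 k) * I)) := by fun_prop
      exact this.aestronglyMeasurable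
    · rw [Complex.norm_exp_ofReal_mul_I]
  have h4 := integral_prod_symm _ hint
  calc _ = _ := by
        congr 1 with p
        rw [smul_eq_mul, ← mul_assoc, ← Complex.exp_add, WithLp.prod_inner_apply]
        congr 2
        simp only [RCLike.inner_apply, conj_trivial]
        push_cast
        ring
    _ = _ := h4
    _ = _ := by
        congr 1 with ξ
        dsimp only
        rw [integral_const_mul, Real.fourier_eq']
        congr 2 with t
        simp only [RCLike.inner_apply, conj_trivial, smul_eq_mul]
        rw [mul_comm t ρ]

end Backproj

section Final

lemma exists_data (Φ : 𝓢(Pl × ℝ, ℂ)) : ∃ G : 𝓢(ℝ × Pl, ℂ),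
    ∀ ρ k, G (ρ, k) = -(4 * π * I) * ρ * Φ (k, ρ ^ 2 - ‖k‖ ^ 2) := by
  have f1 : Function.HasTemperateGrowth (fun x : ℝ × Pl => x.1) :=
      (ContinuousLinearMap.fst ℝ ℝ Pl).hasTemperateGrowth
  have f2 : Function.HasTemperateGrowth (fun x : ℝ × Pl => x.2) :=
      (ContinuousLinearMap.snd ℝ ℝ Pl).hasTemperateGrowth
  have f3 : Function.HasTemperateGrowth (fun x : ℝ × Pl => ‖x.2‖ ^ 2) :=
    (Function.hasTemperateGrowth_norm_sq (H := Pl)).comp f2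
  have f4 : Function.HasTemperateGrowth (fun x : ℝ × Pl => x.1 ^ 2 - ‖x.2‖ ^ 2) := by fun_prop
  have hm := temperate_prodMk f2 f4
  have hm2 : ∃ (k : ℕ) (C : ℝ), ∀ x : ℝ × Pl, ‖x‖ ≤ C * (1 + ‖(x.2, x.1 ^ 2 - ‖x.2‖ ^ 2)‖) ^ k := by
    refine ⟨1, 1, ?_⟩
    rintro ⟨ρ, k⟩
    simp only [Prod.norm_mk, one_mul, pow_one, Real.norm_eq_abs]
    have h0 := norm_nonneg k
    have h1 := le_max_left ‖k‖ |ρ ^ 2 - ‖k‖ ^ 2|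
    have h2 := (le_abs_self _).trans (le_max_right ‖k‖ |ρ ^ 2 - ‖k‖ ^ 2|)
    refine max_le ?_ (by linarith)
    refine abs_le_of_sq_le_sq ?_ (by linarith)
    nlinarith
  let G0 : 𝓢(ℝ × Pl, ℂ) := SchwartzMap.smulLeftCLM ℂ (fun y : ℝ × Pl => y.1)
    (SchwartzMap.compCLM ℝ hm hm2 Φ)
  refine ⟨(-(4 * π * I) : ℂ) • G0, fun ρ k => ?_⟩
  rw [smul_apply]
  simp only [G0]
  rw [SchwartzMap.smulLeftCLM_apply_apply f1, smul_eq_mul, real_smul, ← mul_assoc]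
  rfl

lemma fourier_even (φ' : 𝓢(Sp, ℂ))
    (hev : ∀ (x : Pl) (z : ℝ), φ' (WithLp.toLp 2 (x, -z)) = φ' (WithLp.toLp 2 (x, z)))
    (k : Pl) (ζ : ℝ) : 𝓕 (φ' : Sp → ℂ) (WithLp.toLp 2 (k, -ζ)) = 𝓕 (φ' : Sp → ℂ) (WithLp.toLp 2 (k, ζ)) := by
  let A : Sp ≃ₗᵢ[ℝ] Sp := LinearIsometryEquiv.withLpProdCongr 2 (LinearIsometryEquiv.refl ℝ Pl)
    (LinearIsometryEquiv.neg ℝ)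
  have hA : ∀ (x : Pl) (z : ℝ), A (WithLp.toLp 2 (x, z)) = WithLp.toLp 2 (x, -z) := fun x z => rfl
  have h := Real.fourier_comp_linearIsometry A (φ' : Sp → ℂ) (WithLp.toLp 2 (k, ζ))
  rw [hA] at h
  rw [← h]
  have : (φ' : Sp → ℂ) ∘ A = φ' := by
    funext y
    exact hev y.fst y.snd
  rw [this]

lemma fourierInv_odd (G : 𝓢(ℝ × Pl, ℂ)) (hodd : ∀ t k, G (-t, k) = - G (t, k)) (t : ℝ) (ξ : Pl) :
    𝓕⁻ (fun y : WithLp 2 (ℝ × Pl) => G y.ofLp) (WithLp.toLp 2 (-t, ξ)) =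
      - 𝓕⁻ (fun y : WithLp 2 (ℝ × Pl) => G y.ofLp) (WithLp.toLp 2 (t, ξ)) := by
  let A : WithLp 2 (ℝ × Pl) ≃ₗᵢ[ℝ] WithLp 2 (ℝ × Pl) :=
    LinearIsometryEquiv.withLpProdCongr 2 (LinearIsometryEquiv.neg ℝ) (LinearIsometryEquiv.refl ℝ Pl)
  have hA : ∀ (x : ℝ) (z : Pl), A (WithLp.toLp 2 (x, z)) = WithLp.toLp 2 (-x, z) := fun x z => rfl
  have h := Real.fourierInv_comp_linearIsometry A (fun y : WithLp 2 (ℝ × Pl) => G y.ofLp)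
    (WithLp.toLp 2 (t, ξ))
  rw [hA] at h
  rw [← h]
  have : (fun y : WithLp 2 (ℝ × Pl) => G y.ofLp) ∘ A = fun y => - G y.ofLp := by
    funext y
    exact hodd y.fst y.snd
  rw [this, Real.fourierInv_eq', Real.fourierInv_eq']
  simp [integral_neg]

lemma ae_ne_zero_gen (E : Type) [NormedAddCommGroup E] [InnerProductSpace ℝ E]
    [FiniteDimensional ℝ E] [MeasurableSpace E] [BorelSpace E] [Nontrivial E] :
    ∀ᵐ κ : E, κ ≠ 0 :=
  compl_mem_ae_iff.2 (measure_singleton (0 : E))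

lemma ae_ne_zero_sp : ∀ᵐ κ : Sp, κ ≠ 0 := by
  have : Nontrivial Sp := Module.nontrivial_of_finrank_pos (R := ℝ) (by rw [finrank_sp]; norm_num)
  exact ae_ne_zero_gen Sp

lemma inversion_sp (φ' : 𝓢(Sp, ℂ)) (u : Sp → ℂ) (hui : Integrable u) (huc : Continuous u)
    (hFu : ∀ κ : Sp, κ ≠ 0 → 𝓕 u κ = 4 * π * 𝓕 (φ' : Sp → ℂ) κ) (y : Sp) :
    u y = 4 * π * φ' y := by
  have hae : 𝓕 u =ᵐ[volume] fun κ => 4 * π * 𝓕 (φ' : Sp → ℂ) κ := by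
    filter_upwards [ae_ne_zero_sp] with κ hκ using hFu κ hκ
  have hφi : Integrable (𝓕 (φ' : Sp → ℂ)) := by
    rw [← SchwartzMap.fourier_coe]
    exact (𝓕 φ').integrable
  have hFi : Integrable (𝓕 u) := (hφi.const_mul (4 * π : ℂ)).congr hae.symm
  have e1 := congrFun (huc.fourierInv_fourier_eq hui hFi) y
  have e2 := congrFun (φ'.continuous.fourierInv_fourier_eq φ'.integrable hφi) y
  rw [← e1, ← e2, Real.fourierInv_eq', Real.fourierInv_eq', ← integral_const_mul]
  refine integral_congr_ae ?_
  filter_upwards [hae] with κ hκ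
  rw [hκ, smul_eq_mul, smul_eq_mul]
  ring

set_option maxHeartbeats 1000000 in
lemma main_exists (φ : 𝓢(Pl × ℝ, ℂ)) (hev : ∀ (x : Pl) (z : ℝ), φ (x, -z) = φ (x, z)) :
    ∃ g : 𝓢(ℝ × Pl, ℂ), ∀ (x : Pl) (z : ℝ),
      ∫ ξ, Kern g (WithLp.toLp 2 (x, z), ξ) = 4 * π * φ (x, z) := by
  let φ' : 𝓢(Sp, ℂ) := SchwartzMap.compCLMOfContinuousLinearEquiv ℝ
    (WithLp.prodContinuousLinearEquiv 2 ℝ Pl ℝ) φ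
  have hφ' : ∀ x z, φ' (WithLp.toLp 2 (x, z)) = φ (x, z) := fun x z => rfl
  let φh : 𝓢(Sp, ℂ) := 𝓕 φ'
  have hφh : (φh : Sp → ℂ) = 𝓕 (φ' : Sp → ℂ) := SchwartzMap.fourier_coe φ'
  let ψ0 : 𝓢(Pl × ℝ, ℂ) := SchwartzMap.compCLMOfContinuousLinearEquiv ℝ
    (WithLp.prodContinuousLinearEquiv 2 ℝ Pl ℝ).symm φh
  have hψ0 : ∀ k ζ, ψ0 (k, ζ) = φh (WithLp.toLp 2 (k, ζ)) := fun k ζ => rfl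
  obtain ⟨Φ, hΦ⟩ := whitney ψ0 (fun k ζ => by
    rw [hψ0, hψ0, hφh]
    exact fourier_even φ' (fun x z => by rw [hφ', hφ', hev]) k ζ)
  obtain ⟨G, hG⟩ := exists_data Φ
  have hGodd : ∀ t k, G (-t, k) = - G (t, k) := by
    intro t k
    rw [hG, hG, neg_sq]; push_cast; ring
  let G' : 𝓢(WithLp 2 (ℝ × Pl), ℂ) := SchwartzMap.compCLMOfContinuousLinearEquiv ℝ
    (WithLp.prodContinuousLinearEquiv 2 ℝ ℝ Pl) G
  have hG' : (G' : WithLp 2 (ℝ × Pl) → ℂ) = fun y => G y.ofLp := rfl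
  let g' : 𝓢(WithLp 2 (ℝ × Pl), ℂ) := 𝓕⁻ G'
  have hg' : (g' : WithLp 2 (ℝ × Pl) → ℂ) = 𝓕⁻ (G' : WithLp 2 (ℝ × Pl) → ℂ) :=
    SchwartzMap.fourierInv_coe G'
  let g : 𝓢(ℝ × Pl, ℂ) := SchwartzMap.compCLMOfContinuousLinearEquiv ℝ
    (WithLp.prodContinuousLinearEquiv 2 ℝ ℝ Pl).symm g'
  have hg : ∀ t ξ, g (t, ξ) = g' (WithLp.toLp 2 (t, ξ)) := fun t ξ => rfl
  have hg2 : (fun y : WithLp 2 (ℝ × Pl) => g y.ofLp) = g' := rfl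
  have hodd : ∀ t ξ, g (-t, ξ) = - g (t, ξ) := by
    intro t ξ
    rw [hg, hg, hg', hG']
    exact fourierInv_odd G hGodd t ξ
  have hFg : 𝓕 (g' : WithLp 2 (ℝ × Pl) → ℂ) = G' := by
    rw [← SchwartzMap.fourier_coe]
    exact congrArg _ (FourierTransform.fourier_fourierInv_eq (E := 𝓢(WithLp 2 (ℝ × Pl), ℂ)) G')
  refine ⟨g, fun x z => ?_⟩
  set u : Sp → ℂ := fun x => ∫ ξ, Kern g (x, ξ) with hu
  have hui : Integrable u := (integrable_Kern g hodd).integral_prod_left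
  have huc : Continuous u := continuous_backproj g hodd
  have hFu : ∀ κ : Sp, κ ≠ 0 → 𝓕 u κ = 4 * π * φh κ := by
    intro κ hκ
    have h1 := fourier_backproj g hodd κ
    rw [← fourier_prod, hg2, hFg, hG'] at h1
    simp only [hG] at h1
    have h2 : ‖κ‖ ^ 2 - ‖κ.fst‖ ^ 2 = κ.snd ^ 2 := by
      rw [WithLp.prod_norm_sq_eq_of_L2]
      simp
    rw [h2, hΦ, hψ0] at h1
    have h3 : (I * ‖κ‖ : ℂ) ≠ 0 := by simpa using hκ
    apply mul_left_cancel₀ h3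
    rw [h1]
    have h4 : WithLp.toLp 2 (κ.fst, κ.snd) = κ := rfl
    rw [h4]
    ring
  exact inversion_sp φ' u hui huc (fun κ hκ => by rw [hFu κ hκ, hφh]) (WithLp.toLp 2 (x, z))

end Final

theorem stmt6 (φ : SchwartzMap (EuclideanSpace ℝ (Fin 2) × ℝ) ℂ)
    (hφeven : ∀ (x₁₂ : EuclideanSpace ℝ (Fin 2)) (x₃ : ℝ), φ (x₁₂, -x₃) = φ (x₁₂, x₃)) :
    ∃ g : SchwartzMap (ℝ × EuclideanSpace ℝ (Fin 2)) ℂ,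
      ∀ (x₁₂ : EuclideanSpace ℝ (Fin 2)) (x₃ : ℝ),
        Rstar (⇑g) (x₁₂, x₃) = φ (x₁₂, x₃) := by
  obtain ⟨g, hg⟩ := main_exists φ hφeven
  refine ⟨g, fun x z => ?_⟩
  have h := hg x z
  have e : ∀ ξ : Pl, ‖(WithLp.toLp 2 (x, z) : Sp) - iot ξ‖ = √(‖x - ξ‖ ^ 2 + z ^ 2) := by
    intro ξ
    rw [WithLp.prod_norm_eq_of_L2]
    simp [iot]
  simp only [Kern, e] at h
  unfold Rstar
  simp only
  rw [h]
  have : (π : ℂ) ≠ 0 := by exact_mod_cast Real.pi_ne_zero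
  push_cast
  field_simp
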